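/- Let 𝒜 be an abelian category with enough projectives and injectives, let 𝒢𝒫_𝒜 denote the class of Gorenstein projective objects of 𝒜 and 𝒫_𝒜 the class of projective objects of 𝒜. Then (𝒢𝒫_𝒜, 𝒫_𝒜) is a strong left Frobenius pair in 𝒜. -/

import Mathlib

/-!
Formalization of a statement from "Recollements induced by left Frobenius pairs"
(Ma, Sun, Zhu, Hu). Auxiliary definitions (left Frobenius pairs, the classes
`𝒳̂` and `𝔅^𝒳_𝒴`, etc.) are given first; the statement itself is the final theorem.
-/

noncomputable section
namespace Paper
open CategoryTheory CategoryTheory.Limits ZeroObject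

universe w₁ w₂ w₃ v v' u u'

section Core
variable {𝒜 : Type u} [Category.{v} 𝒜] [Abelian 𝒜]

/-- `C` is isomorphic to some member of the class `𝒳`. -/
def MemIso (𝒳 : Set 𝒜) (C : 𝒜) : Prop := ∃ X ∈ 𝒳, Nonempty (X ≅ C)

/-- `C` admits an exact resolution `0 → X_n → ⋯ → X_0 → C → 0` with all `X_i ∈ 𝒳`. -/
def HasResolutionOfLength (𝒳 : Set 𝒜) : ℕ → 𝒜 → Prop
  | 0, C => MemIso 𝒳 C
  | (n+1), C => ∃ S : ShortComplex 𝒜, S.ShortExact ∧ S.X₃ = C ∧ S.X₂ ∈ 𝒳 ∧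
      HasResolutionOfLength 𝒳 n S.X₁

/-- The class `𝒳̂` of objects admitting a finite exact resolution by objects of `𝒳`. -/
def Hat (𝒳 : Set 𝒜) : Set 𝒜 := {C | ∃ n, HasResolutionOfLength 𝒳 n C}

variable [HasExt.{w₁} 𝒜]

/-- `(𝒳, 𝒲)` is a left Frobenius pair in the abelian category `𝒜`:
`𝒳` is closed under extensions, kernels of epimorphisms and direct summands,
`𝒲` is closed under direct summands, `𝒲 ⊆ 𝒳 ∩ 𝒳^⊥`, and every `X ∈ 𝒳` admits a
short exact sequence `0 → X → W → X' → 0` with `W ∈ 𝒲`, `X' ∈ 𝒳`. -/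
structure IsLeftFrobeniusPair (𝒳 𝒲 : Set 𝒜) : Prop where
  closed_extensions : ∀ S : ShortComplex 𝒜, S.ShortExact → S.X₁ ∈ 𝒳 → S.X₃ ∈ 𝒳 → S.X₂ ∈ 𝒳
  closed_kernels_of_epis : ∀ S : ShortComplex 𝒜, S.ShortExact → S.X₂ ∈ 𝒳 → S.X₃ ∈ 𝒳 → S.X₁ ∈ 𝒳
  closed_summands_X : ∀ C A B : 𝒜, C ∈ 𝒳 → Nonempty (C ≅ A ⊞ B) → A ∈ 𝒳
  closed_summands_W : ∀ C A B : 𝒜, C ∈ 𝒲 → Nonempty (C ≅ A ⊞ B) → A ∈ 𝒲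
  W_subset_X : 𝒲 ⊆ 𝒳
  W_subset_rightPerp : ∀ W ∈ 𝒲, ∀ X ∈ 𝒳, ∀ i : ℕ, 1 ≤ i → Subsingleton (Abelian.Ext X W i)
  cogenerator : ∀ X ∈ 𝒳, ∃ S : ShortComplex 𝒜, S.ShortExact ∧ S.X₁ = X ∧ S.X₂ ∈ 𝒲 ∧ S.X₃ ∈ 𝒳

/-- `(𝒳, 𝒲)` is a strong left Frobenius pair: a left Frobenius pair such that moreover
`𝒲 ⊆ ^⊥𝒳` and every `X ∈ 𝒳` admits a short exact sequence `0 → X' → W → X → 0`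
with `W ∈ 𝒲`, `X' ∈ 𝒳`. -/
structure IsStrongLeftFrobeniusPair (𝒳 𝒲 : Set 𝒜) extends IsLeftFrobeniusPair 𝒳 𝒲 : Prop where
  W_subset_leftPerp : ∀ W ∈ 𝒲, ∀ X ∈ 𝒳, ∀ i : ℕ, 1 ≤ i → Subsingleton (Abelian.Ext W X i)
  generator : ∀ X ∈ 𝒳, ∃ S : ShortComplex 𝒜, S.ShortExact ∧ S.X₃ = X ∧ S.X₂ ∈ 𝒲 ∧ S.X₁ ∈ 𝒳

end Core

section GorensteinProjective
variable {𝒜 : Type u} [Category.{v} 𝒜] [Abelian 𝒜]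

/-- The complex `Hom_𝒜(P^•, Q)` of abelian groups is exact. -/
def HomComplexExact (P : CochainComplex 𝒜 ℤ) (Q : 𝒜) : Prop :=
  ∀ n, ((((preadditiveYoneda.obj Q).mapHomologicalComplex _).obj
    (HomologicalComplex.op P)).ExactAt n)

/-- `M` is a Gorenstein projective object: `M ≅ Z⁰(P^•)` for some acyclic complex `P^•`
of projective objects such that `Hom(P^•, Q)` is exact for every projective `Q`. -/
def IsGorensteinProjective (M : 𝒜) : Prop :=
  ∃ P : CochainComplex 𝒜 ℤ,
    (∀ n, Projective (P.X n)) ∧ (∀ n, P.ExactAt n) ∧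
    (∀ Q : 𝒜, Projective Q → HomComplexExact P Q) ∧
    Nonempty (M ≅ P.cycles 0)

/-- A complete projective resolution: an acyclic complex of projective objects which stays
exact after applying `Hom(-, Q)` for every projective `Q`. -/
def IsCompleteProjectiveResolution (P : CochainComplex 𝒜 ℤ) : Prop :=
  (∀ n, Projective (P.X n)) ∧ (∀ n, P.ExactAt n) ∧
    ∀ Q : 𝒜, Projective Q → HomComplexExact P Q

variable {ℬ : Type u'} [Category.{v'} ℬ] [Abelian ℬ]

/-- Condition (C1): `T` sends exact complexes of projective objects to exact complexes. -/
def CompatibleC1 (T : ℬ ⥤ 𝒜) [T.Additive] : Prop :=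
  ∀ Q : CochainComplex ℬ ℤ, (∀ n, Projective (Q.X n)) → (∀ n, Q.ExactAt n) →
    ∀ n, ((T.mapHomologicalComplex _).obj Q).ExactAt n

/-- Condition (C2): `Hom_𝒜(P^•, T Q)` is exact for every complete `𝒜`-projective
resolution `P^•` and every projective object `Q` of `ℬ`. -/
def CompatibleC2 (T : ℬ ⥤ 𝒜) : Prop :=
  ∀ P : CochainComplex 𝒜 ℤ, IsCompleteProjectiveResolution P →
    ∀ Q : ℬ, Projective Q → HomComplexExact P (T.obj Q)

/-- `T` is a compatible functor. -/
def Compatible (T : ℬ ⥤ 𝒜) [T.Additive] : Prop := CompatibleC1 T ∧ CompatibleC2 T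

end GorensteinProjective

end Paper

open CategoryTheory CategoryTheory.Limits ZeroObject Paper

universe w₁ w₂ w₃ v v' u u'

namespace Paper

/-- A relation which is total on both sides has a bi-infinite orbit through every point. -/
lemma exists_int_orbit {T : Type*} (R : T → T → Prop) (hs : ∀ t, ∃ t', R t t')
    (hp : ∀ t, ∃ t', R t' t) (t : T) :
    ∃ s : ℤ → T, s 0 = t ∧ ∀ n, R (s n) (s (n + 1)) := by
  choose succ hsucc using hs
  choose pred hpred using hp
  refine ⟨fun n => Int.casesOn n (fun k => succ^[k] t) (fun k => pred^[k + 1] t), rfl, ?_⟩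
  rintro (k | k)
  · change R (succ^[k] t) (succ^[k + 1] t)
    rw [Function.iterate_succ_apply']
    exact hsucc _
  · cases k with
    | zero => exact hpred t
    | succ k =>
      have h : Int.negSucc (k + 1) + 1 = Int.negSucc k := by lia
      rw [h]
      change R (pred^[k + 1 + 1] t) (pred^[k + 1] t)
      rw [Function.iterate_succ_apply']
      exact hpred _

section ShortExactSequences
variable {𝒜 : Type u} [Category.{v} 𝒜] [Abelian 𝒜]

/-- If `0 → A → B → C → 0` and `0 → B → P → B' → 0` are exact and `A'` is the cokernel of
`A → B → P`, then `0 → A → P → A' → 0` and `0 → C → A' → B' → 0` are exact. -/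
lemma exists_shortExact_cokernel_comp {A B C P B' : 𝒜} {f : A ⟶ B} {g : B ⟶ C} {w : f ≫ g = 0}
    (h : (ShortComplex.mk f g w).ShortExact) {i : B ⟶ P} {p : P ⟶ B'} {w' : i ≫ p = 0}
    (h' : (ShortComplex.mk i p w').ShortExact) :
    ∃ (A' : 𝒜) (q : P ⟶ A') (wq : (f ≫ i) ≫ q = 0) (j : C ⟶ A') (r : A' ⟶ B') (wr : j ≫ r = 0),
      (ShortComplex.mk (f ≫ i) q wq).ShortExact ∧ (ShortComplex.mk j r wr).ShortExact := by
  have : Mono f := h.mono_f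
  have : Epi g := h.epi_g
  have : Mono i := h'.mono_f
  have : Epi p := h'.epi_g
  obtain ⟨j, hj⟩ := h.exact.desc' (i ≫ cokernel.π (f ≫ i)) (by
    rw [← Category.assoc]
    exact cokernel.condition (f ≫ i))
  dsimp at j hj
  let r : cokernel (f ≫ i) ⟶ B' := cokernel.desc _ p (by simp [w'])
  have hr : cokernel.π (f ≫ i) ≫ r = p := cokernel.π_desc _ _ _
  have hq : (ShortComplex.mk (f ≫ i) (cokernel.π (f ≫ i)) (cokernel.condition _)).Exact :=
    ShortComplex.cokernelSequence_exact _
  have wr : j ≫ r = 0 := by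
    rw [← cancel_epi g, reassoc_of% hj, hr, w', comp_zero]
  have : Epi r := epi_of_epi_fac hr
  have : Mono j := by
    refine Preadditive.mono_of_cancel_zero _ fun {T} x hx => ?_
    obtain ⟨T₁, π₁, _, b, hb⟩ := surjective_up_to_refinements_of_epi g x
    have hbi : (b ≫ i) ≫ cokernel.π (f ≫ i) = 0 := by
      rw [Category.assoc, ← hj, ← reassoc_of% hb, hx, comp_zero]
    obtain ⟨T₂, π₂, _, a, ha⟩ := hq.exact_up_to_refinements _ hbi
    dsimp at a ha
    have hba : π₂ ≫ b = a ≫ f := by simpa [← cancel_mono i] using ha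
    rw [← cancel_epi π₁, hb, ← cancel_epi π₂, reassoc_of% hba, w]
    simp
  refine ⟨_, _, cokernel.condition _, j, r, wr,
    { exact := hq, mono_f := mono_comp f i, epi_g := inferInstanceAs (Epi (cokernel.π _)) },
    { exact := ?_, mono_f := this, epi_g := ‹Epi r› }⟩
  rw [ShortComplex.exact_iff_exact_up_to_refinements]
  intro T x hx
  dsimp at x hx ⊢
  obtain ⟨T₁, π₁, _, y, hy⟩ := surjective_up_to_refinements_of_epi (cokernel.π (f ≫ i)) x
  obtain ⟨b, hb⟩ := h'.exact.lift' y (by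
    have := hy =≫ r
    simpa [hx, hr] using this.symm)
  dsimp at b hb
  exact ⟨T₁, π₁, inferInstance, b ≫ g, by rw [hy, Category.assoc, hj, reassoc_of% hb]⟩

/-- Adding an identity to a short exact sequence. -/
lemma shortExact_biprod_map_id {A B C : 𝒜} {f : A ⟶ B} {g : B ⟶ C} {w : f ≫ g = 0}
    (h : (ShortComplex.mk f g w).ShortExact) (D : 𝒜) :
    (ShortComplex.mk (biprod.map f (𝟙 D)) (biprod.fst ≫ g) (by simp [w])).ShortExact where
  mono_f := by
    have : Mono f := h.mono_f
    exact inferInstanceAs (Mono (biprod.map f (𝟙 D)))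
  epi_g := by
    have : Epi g := h.epi_g
    exact epi_comp _ _
  exact := by
    have : Mono f := h.mono_f
    rw [ShortComplex.exact_iff_exact_up_to_refinements]
    intro T x hx
    dsimp at x hx ⊢
    obtain ⟨a, ha⟩ := h.exact.lift' (x ≫ biprod.fst) (by simpa using hx)
    dsimp at a ha
    refine ⟨T, 𝟙 T, inferInstance, biprod.lift a (x ≫ biprod.snd), ?_⟩
    ext <;> simp [ha]

/-- The pushout sequence `0 → B → C ⊞ P → A' → 0` obtained from short exact sequences
`0 → A → B → C → 0` and `0 → A → P → A' → 0` and an extension of `A → P` to `B`. -/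
lemma exists_shortExact_of_extension {A B C P A' : 𝒜} {f : A ⟶ B} {g : B ⟶ C} {w : f ≫ g = 0}
    (h : (ShortComplex.mk f g w).ShortExact) {i : A ⟶ P} {p : P ⟶ A'} {w' : i ≫ p = 0}
    (h' : (ShortComplex.mk i p w').ShortExact) (e : B ⟶ P) (he : f ≫ e = i) :
    ∃ (q : C ⊞ P ⟶ A') (wq : biprod.lift g e ≫ q = 0),
      (ShortComplex.mk (biprod.lift g e) q wq).ShortExact := by
  have : Mono f := h.mono_f
  have : Epi g := h.epi_g
  have : Mono i := h'.mono_f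
  have : Epi p := h'.epi_g
  obtain ⟨k, hk⟩ := h.exact.desc' (e ≫ p) (by
    dsimp
    rw [reassoc_of% he, w'])
  dsimp at k hk
  refine ⟨biprod.desc (-k) p, by simp [hk],
    { exact := ?_, mono_f := ?_, epi_g := ?_ }⟩
  · rw [ShortComplex.exact_iff_exact_up_to_refinements]
    intro T x hx
    dsimp at x hx ⊢
    obtain ⟨T₁, π₁, _, b, hb⟩ := surjective_up_to_refinements_of_epi g (x ≫ biprod.fst)
    have hx' : x ≫ biprod.snd ≫ p = x ≫ biprod.fst ≫ k := by
      rw [← sub_eq_zero, ← hx, biprod.desc_eq]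
      simp [sub_eq_add_neg, add_comm]
    obtain ⟨a, ha⟩ := h'.exact.lift' (π₁ ≫ x ≫ biprod.snd - b ≫ e) (by
      have := hb =≫ k
      simp only [Category.assoc] at this
      simp [hx', this, hk])
    dsimp at a ha
    refine ⟨T₁, π₁, inferInstance, a ≫ f + b, ?_⟩
    ext
    · simpa [w] using hb
    · simp [he, ha]
  · refine Preadditive.mono_of_cancel_zero _ fun {T} x hx => ?_
    dsimp at x hx
    have h₁ : x ≫ e = 0 := by simpa using hx =≫ biprod.snd
    have h₂ : x ≫ g = 0 := by simpa using hx =≫ biprod.fst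
    obtain ⟨a, ha⟩ := h.exact.lift' x h₂
    dsimp at a ha
    have : a = 0 := by
      rw [← cancel_mono i, ← he, reassoc_of% ha, h₁, zero_comp]
    rw [← ha, this, zero_comp]
  · exact epi_of_epi_fac (f := biprod.inr) (h := p) (by simp)

end ShortExactSequences

section HomComplex
variable {𝒜 : Type u} [Category.{v} 𝒜] [Abelian 𝒜]

lemma homComplexExact_iff (P : CochainComplex 𝒜 ℤ) (Q : 𝒜) :
    HomComplexExact P Q ↔ ∀ (n : ℤ) (f : P.X n ⟶ Q), P.d (n - 1) n ≫ f = 0 →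
      ∃ k : P.X (n + 1) ⟶ Q, P.d n (n + 1) ≫ k = f := by
  refine forall_congr' fun n => ?_
  rw [HomologicalComplex.exactAt_iff' _ (n + 1) n (n - 1)
      (ComplexShape.prev_eq' _ (by simp)) (ComplexShape.next_eq' _ (by simp)),
    ShortComplex.ab_exact_iff]
  rfl

/-- An exact complex breaks into short exact sequences of cycles. -/
lemma shortExact_cycles (P : CochainComplex 𝒜 ℤ) (hP : ∀ n, P.ExactAt n) (n : ℤ) :
    (ShortComplex.mk (P.iCycles n) (P.toCycles n (n + 1)) (by
      simp [← cancel_mono (P.iCycles (n + 1))])).ShortExact where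
  mono_f := inferInstanceAs (Mono (P.iCycles n))
  epi_g := by
    dsimp
    rw [epi_iff_surjective_up_to_refinements]
    intro T y
    obtain ⟨T', π, hπ, x, hx⟩ :=
      (P.exactAt_iff_exact_up_to_refinements n (n + 1) (n + 1 + 1) (by simp) (by simp)).1
        (hP (n + 1)) (y ≫ P.iCycles (n + 1)) (by simp)
    exact ⟨T', π, hπ, x, by simp [← cancel_mono (P.iCycles (n + 1)), hx]⟩
  exact := by
    rw [ShortComplex.exact_iff_exact_up_to_refinements]
    intro T x hx
    dsimp at x hx ⊢
    have hx' : x ≫ P.d n (n + 1) = 0 := by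
      simpa using hx =≫ P.iCycles (n + 1)
    exact ⟨T, 𝟙 T, inferInstance, P.liftCycles x (n + 1) (by simp) hx', by simp⟩

end HomComplex

section ProjectiveOrthogonal
variable {𝒜 : Type u} [Category.{v} 𝒜] [Abelian 𝒜] [HasExt.{w₁} 𝒜]

/-- `Ext^i(M, Q) = 0` for all projective `Q` and all `i ≥ 1`. -/
def IsOrthogonalToProjectives (M : 𝒜) : Prop :=
  ∀ Q : 𝒜, Projective Q → ∀ i : ℕ, Subsingleton (Abelian.Ext M Q (i + 1))

lemma isOrthogonalToProjectives_of_projective (M : 𝒜) [Projective M] :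
    IsOrthogonalToProjectives M :=
  fun _ _ _ => Abelian.Ext.subsingleton_of_projective _ _ _

lemma IsOrthogonalToProjectives.of_retract {M N : 𝒜} (hM : IsOrthogonalToProjectives M)
    (i : N ⟶ M) (r : M ⟶ N) (hir : i ≫ r = 𝟙 N) : IsOrthogonalToProjectives N := by
  refine fun Q hQ n => subsingleton_of_forall_eq 0 fun x => ?_
  have := hM Q hQ n
  rw [← Abelian.Ext.mk₀_id_comp x, ← hir, ← Abelian.Ext.mk₀_comp_mk₀_assoc,
    Subsingleton.elim ((Abelian.Ext.mk₀ r).comp x (zero_add _)) 0, Abelian.Ext.comp_zero]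

variable {S : ShortComplex 𝒜}

lemma IsOrthogonalToProjectives.exists_extension (hS : S.ShortExact)
    (h : IsOrthogonalToProjectives S.X₃) {Q : 𝒜}
    (hQ : Projective Q) (f : S.X₁ ⟶ Q) : ∃ k : S.X₂ ⟶ Q, S.f ≫ k = f := by
  have := h Q hQ 0
  obtain ⟨x, hx⟩ := Abelian.Ext.contravariant_sequence_exact₁ hS Q (Abelian.Ext.mk₀ f)
    (n₁ := 0 + 1) rfl (Subsingleton.elim _ _)
  obtain ⟨k, rfl⟩ := (Abelian.Ext.mk₀_bijective _ _).2 x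
  rw [Abelian.Ext.mk₀_comp_mk₀] at hx
  exact ⟨k, (Abelian.Ext.mk₀_bijective _ _).1 hx⟩

lemma IsOrthogonalToProjectives.extension (hS : S.ShortExact)
    (h₁ : IsOrthogonalToProjectives S.X₁)
    (h₃ : IsOrthogonalToProjectives S.X₃) : IsOrthogonalToProjectives S.X₂ := by
  refine fun Q hQ n => subsingleton_of_forall_eq 0 fun x => ?_
  have := h₁ Q hQ n
  have := h₃ Q hQ n
  obtain ⟨y, rfl⟩ := Abelian.Ext.contravariant_sequence_exact₂ hS Q x (Subsingleton.elim _ _)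
  rw [Subsingleton.elim y 0, Abelian.Ext.comp_zero]

lemma IsOrthogonalToProjectives.kernel (hS : S.ShortExact)
    (h₂ : IsOrthogonalToProjectives S.X₂)
    (h₃ : IsOrthogonalToProjectives S.X₃) : IsOrthogonalToProjectives S.X₁ := by
  refine fun Q hQ n => subsingleton_of_forall_eq 0 fun x => ?_
  have := h₂ Q hQ n
  have := h₃ Q hQ (n + 1)
  obtain ⟨y, rfl⟩ := Abelian.Ext.contravariant_sequence_exact₁ hS Q x (n₁ := n + 1 + 1)
    (by lia) (Subsingleton.elim _ _)
  rw [Subsingleton.elim y 0, Abelian.Ext.comp_zero]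

lemma subsingleton_ext_one_of_extension (hS : S.ShortExact) [Projective S.X₂] (Q : 𝒜)
    (h : ∀ f : S.X₁ ⟶ Q, ∃ k : S.X₂ ⟶ Q, S.f ≫ k = f) :
    Subsingleton (Abelian.Ext S.X₃ Q 1) := by
  refine subsingleton_of_forall_eq 0 fun x => ?_
  obtain ⟨y, rfl⟩ := Abelian.Ext.contravariant_sequence_exact₃ hS Q x
    (Abelian.Ext.eq_zero_of_projective (n := 0) _) (n₀ := 0) rfl
  obtain ⟨f, rfl⟩ := (Abelian.Ext.mk₀_bijective _ _).2 y
  obtain ⟨k, rfl⟩ := h f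
  rw [← Abelian.Ext.mk₀_comp_mk₀, hS.extClass_comp_assoc]

lemma subsingleton_ext_succ (hS : S.ShortExact) [Projective S.X₂] (Q : 𝒜) (n : ℕ)
    [Subsingleton (Abelian.Ext S.X₁ Q n)] : Subsingleton (Abelian.Ext S.X₃ Q (n + 1)) := by
  refine subsingleton_of_forall_eq 0 fun x => ?_
  obtain ⟨y, rfl⟩ := Abelian.Ext.contravariant_sequence_exact₃ hS Q x
    (Abelian.Ext.eq_zero_of_projective (n := n) _) (n₀ := n) (by lia)
  rw [Subsingleton.elim y 0, Abelian.Ext.comp_zero]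

end ProjectiveOrthogonal

section Coresolution
variable {𝒜 : Type u} [Category.{v} 𝒜] [Abelian 𝒜]

/-- `X` embeds in a projective object with cokernel in `𝒞`. -/
def HasProjectiveEmbedding (𝒞 : 𝒜 → Prop) (X : 𝒜) : Prop :=
  ∃ (P Y : 𝒜) (f : X ⟶ P) (g : P ⟶ Y) (w : f ≫ g = 0),
    Projective P ∧ (ShortComplex.mk f g w).ShortExact ∧ 𝒞 Y

lemma HasProjectiveEmbedding.mono {𝒞 𝒟 : 𝒜 → Prop} (h : ∀ Y, 𝒞 Y → 𝒟 Y) {X : 𝒜}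
    (hX : HasProjectiveEmbedding 𝒞 X) : HasProjectiveEmbedding 𝒟 X := by
  obtain ⟨P, Y, f, g, w, hP, hS, hY⟩ := hX
  exact ⟨P, Y, f, g, w, hP, hS, h Y hY⟩

variable [HasExt.{w₁} 𝒜]

/-- `M` belongs to a class of objects orthogonal to the projectives, each of which embeds in a
projective object with cokernel in the class. -/
def HasOrthogonalCoresolution (M : 𝒜) : Prop :=
  ∃ 𝒞 : 𝒜 → Prop, 𝒞 M ∧ ∀ X, 𝒞 X → IsOrthogonalToProjectives X ∧ HasProjectiveEmbedding 𝒞 X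

namespace HasOrthogonalCoresolution

lemma orthogonal {M : 𝒜} (h : HasOrthogonalCoresolution M) : IsOrthogonalToProjectives M := by
  obtain ⟨𝒞, hM, h⟩ := h
  exact (h M hM).1

lemma embedding {M : 𝒜} (h : HasOrthogonalCoresolution M) :
    HasProjectiveEmbedding HasOrthogonalCoresolution M := by
  obtain ⟨𝒞, hM, h⟩ := h
  exact (h M hM).2.mono fun Y hY => ⟨𝒞, hY, h⟩

/-- Coinduction principle. -/
lemma of_class (𝒞 : 𝒜 → Prop) (h : ∀ X, 𝒞 X → IsOrthogonalToProjectives X ∧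
      HasProjectiveEmbedding (fun Y => 𝒞 Y ∨ HasOrthogonalCoresolution Y) X)
    {M : 𝒜} (hM : 𝒞 M) : HasOrthogonalCoresolution M := by
  refine ⟨fun Y => 𝒞 Y ∨ HasOrthogonalCoresolution Y, Or.inl hM, ?_⟩
  rintro X (hX | hX)
  · exact h X hX
  · exact ⟨hX.orthogonal, hX.embedding.mono fun _ => Or.inr⟩

lemma of_embedding {M : 𝒜} (h : IsOrthogonalToProjectives M)
    (h' : HasProjectiveEmbedding HasOrthogonalCoresolution M) : HasOrthogonalCoresolution M :=
  of_class (fun X => X = M) (by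
    rintro _ rfl
    exact ⟨h, h'.mono fun _ => Or.inr⟩) rfl

lemma of_iso {M N : 𝒜} (h : HasOrthogonalCoresolution M) (e : M ≅ N) :
    HasOrthogonalCoresolution N := by
  refine of_embedding (h.orthogonal.of_retract e.inv e.hom (by simp)) ?_
  obtain ⟨P, Y, f, g, w, hP, hS, hY⟩ := h.embedding
  refine ⟨P, Y, e.inv ≫ f, g, by simp [w], hP, ?_, hY⟩
  let φ : ShortComplex.mk f g w ≅ ShortComplex.mk (e.inv ≫ f) g (by simp [w]) :=
    ShortComplex.isoMk e (Iso.refl _) (Iso.refl _) (by simp) (by simp)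
  exact ShortComplex.shortExact_of_iso φ hS

lemma of_projective (M : 𝒜) [Projective M] : HasOrthogonalCoresolution M := by
  refine of_class (fun X => Projective X) (fun X hX =>
    ⟨isOrthogonalToProjectives_of_projective X, X, 0, 𝟙 X, 0, by simp, hX, ?_,
      Or.inl inferInstance⟩) ‹_›
  exact (ShortComplex.Splitting.mk (S := ShortComplex.mk (𝟙 X) (0 : X ⟶ 0) (by simp))
    (𝟙 X) 0).shortExact

lemma extension {S : ShortComplex 𝒜} (hS : S.ShortExact) (h₁ : HasOrthogonalCoresolution S.X₁)
    (h₃ : HasOrthogonalCoresolution S.X₃) : HasOrthogonalCoresolution S.X₂ := by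
  refine of_class (fun B => ∃ S : ShortComplex 𝒜, S.ShortExact ∧ HasOrthogonalCoresolution S.X₁ ∧
    HasOrthogonalCoresolution S.X₃ ∧ S.X₂ = B) ?_ ⟨S, hS, h₁, h₃, rfl⟩
  rintro _ ⟨S, hS, h₁, h₃, rfl⟩
  refine ⟨.extension hS h₁.orthogonal h₃.orthogonal, ?_⟩
  obtain ⟨P₁, Y₁, f₁, g₁, w₁, hP₁, hS₁, hY₁⟩ := h₁.embedding
  obtain ⟨P₃, Y₃, f₃, g₃, w₃, hP₃, hS₃, hY₃⟩ := h₃.embedding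
  obtain ⟨e, he⟩ := h₃.orthogonal.exists_extension hS hP₁ f₁
  obtain ⟨q, wq, hq⟩ := exists_shortExact_of_extension hS hS₁ e he
  obtain ⟨B', r, wr, j, t, wt, h, h'⟩ := exists_shortExact_cokernel_comp hq
    (shortExact_biprod_map_id hS₃ P₁)
  exact ⟨_, B', _, r, wr, inferInstance, h, Or.inl ⟨_, h', hY₁, hY₃, rfl⟩⟩

lemma kernel {S : ShortComplex 𝒜} (hS : S.ShortExact) (h₂ : HasOrthogonalCoresolution S.X₂)
    (h₃ : HasOrthogonalCoresolution S.X₃) : HasOrthogonalCoresolution S.X₁ := by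
  refine of_embedding (.kernel hS h₂.orthogonal h₃.orthogonal) ?_
  obtain ⟨P, Y, f, g, w, hP, hS', hY⟩ := h₂.embedding
  obtain ⟨A', r, wr, j, t, wt, h, h'⟩ := exists_shortExact_cokernel_comp hS hS'
  exact ⟨P, A', _, r, wr, hP, h, extension h' h₃ hY⟩

lemma of_biprod {A B : 𝒜} (h : HasOrthogonalCoresolution (A ⊞ B)) :
    HasOrthogonalCoresolution A := by
  refine of_class (fun A => ∃ B, HasOrthogonalCoresolution (A ⊞ B)) ?_ ⟨B, h⟩
  rintro A ⟨B, h⟩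
  refine ⟨h.orthogonal.of_retract biprod.inl biprod.fst (by simp), ?_⟩
  obtain ⟨P, Y, f, g, w, hP, hS, hY⟩ := h.embedding
  have hAB : (ShortComplex.mk (biprod.inl : A ⟶ A ⊞ B) biprod.snd (by simp)).ShortExact :=
    (ShortComplex.Splitting.ofHasBinaryBiproduct A B).shortExact
  obtain ⟨A', r, wr, j, t, wt, h₁, h₂⟩ := exists_shortExact_cokernel_comp hAB hS
  exact ⟨P, A', _, r, wr, hP, h₁, Or.inl ⟨A, extension (shortExact_biprod_map_id h₂ A)
    (h.of_iso (biprod.braiding _ _)) hY⟩⟩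

end HasOrthogonalCoresolution

end Coresolution

section GorensteinProjectiveCoresolution
variable {𝒜 : Type u} [Category.{v} 𝒜] [Abelian 𝒜] [HasExt.{w₁} 𝒜]

lemma isOrthogonalToProjectives_cycles {P : CochainComplex 𝒜 ℤ}
    (hP : IsCompleteProjectiveResolution P) (n : ℤ) :
    IsOrthogonalToProjectives (P.cycles n) := by
  intro Q hQ i
  induction i generalizing n with
  | zero =>
    obtain ⟨m, rfl⟩ : ∃ m, n = m + 1 := ⟨n - 1, by lia⟩
    obtain ⟨l, rfl⟩ : ∃ l, m = l + 1 := ⟨m - 1, by lia⟩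
    have := hP.1 (l + 1)
    refine subsingleton_ext_one_of_extension (shortExact_cycles P hP.2.1 (l + 1)) Q fun f => ?_
    dsimp at f ⊢
    obtain ⟨k, hk⟩ := (homComplexExact_iff P Q).1 (hP.2.2 Q hQ) l (P.toCycles l (l + 1) ≫ f)
      (by simp)
    have : Epi (P.toCycles l (l + 1)) := (shortExact_cycles P hP.2.1 l).epi_g
    exact ⟨k, by simp [← cancel_epi (P.toCycles l (l + 1)), hk]⟩
  | succ i ih =>
    obtain ⟨m, rfl⟩ : ∃ m, n = m + 1 := ⟨n - 1, by lia⟩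
    have := hP.1 m
    have := ih m
    exact subsingleton_ext_succ (shortExact_cycles P hP.2.1 m) Q (i + 1)

lemma IsGorensteinProjective.hasOrthogonalCoresolution {M : 𝒜} (h : IsGorensteinProjective M) :
    HasOrthogonalCoresolution M := by
  obtain ⟨P, hP, hP', hQ, ⟨e⟩⟩ := h
  refine HasOrthogonalCoresolution.of_iso ?_ e.symm
  refine ⟨fun X => ∃ n, P.cycles n = X, ⟨0, rfl⟩, ?_⟩
  rintro _ ⟨n, rfl⟩
  exact ⟨isOrthogonalToProjectives_cycles ⟨hP, hP', hQ⟩ n, P.X n, _, _, _, _, hP n,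
    shortExact_cycles P hP' n, n + 1, rfl⟩

/-- Splicing of a bi-infinite sequence of short exact sequences with projective middle terms. -/
lemma isGorensteinProjective_of_splice (S : ℤ → ShortComplex 𝒜) (hS : ∀ n, (S n).ShortExact)
    (hP : ∀ n, Projective (S n).X₂) (h : ∀ n, IsOrthogonalToProjectives (S n).X₃)
    (e : ∀ n, (S n).X₃ ≅ (S (n + 1)).X₁) : IsGorensteinProjective (S 0).X₁ := by
  have := fun n => (hS n).mono_f
  have := fun n => (hS n).epi_g
  let d (n : ℤ) : (S n).X₂ ⟶ (S (n + 1)).X₂ := (S n).g ≫ (e n).hom ≫ (S (n + 1)).f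
  let P : CochainComplex 𝒜 ℤ := CochainComplex.of (fun n => (S n).X₂) d (by simp [d])
  have hd (n : ℤ) : P.d n (n + 1) = (S n).g ≫ (e n).hom ≫ (S (n + 1)).f :=
    CochainComplex.of_d (fun n => (S n).X₂) d n
  have hd_eq_zero {T : 𝒜} (n : ℤ) (x : T ⟶ (S n).X₂) :
      x ≫ P.d n (n + 1) = 0 → x ≫ (S n).g = 0 := fun hx => by
    have : (x ≫ (S n).g) ≫ (e n).hom ≫ (S (n + 1)).f = 0 := by
      rw [Category.assoc, ← hd, hx]
    simpa [← cancel_mono ((e n).hom ≫ (S (n + 1)).f)] using this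
  refine ⟨P, hP, fun n => ?_, fun Q hQ => (homComplexExact_iff P Q).2 fun n f hf => ?_, ⟨?_⟩⟩
  · obtain ⟨m, rfl⟩ : ∃ m, n = m + 1 := ⟨n - 1, by lia⟩
    rw [P.exactAt_iff_exact_up_to_refinements m (m + 1) (m + 1 + 1) (by simp) (by simp)]
    intro T x hx
    obtain ⟨y, rfl⟩ := (hS (m + 1)).exact.lift' x (hd_eq_zero _ x hx)
    obtain ⟨T', π, hπ, z, hz⟩ := surjective_up_to_refinements_of_epi ((S m).g ≫ (e m).hom) y
    exact ⟨T', π, hπ, z, by rw [hd, reassoc_of% hz]⟩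
  · obtain ⟨m, rfl⟩ : ∃ m, n = m + 1 := ⟨n - 1, by lia⟩
    rw [show m + 1 - 1 = m by lia, hd] at hf
    have hf' : (S (m + 1)).f ≫ f = 0 := by
      rw [← cancel_epi ((S m).g ≫ (e m).hom)]
      simpa using hf
    obtain ⟨k, rfl⟩ := (hS (m + 1)).exact.desc' f hf'
    obtain ⟨l, hl⟩ := (h (m + 1 + 1)).exists_extension (hS (m + 1 + 1)) hQ
      ((e (m + 1)).inv ≫ k)
    exact ⟨l, by rw [hd]; simp [hl]⟩
  · have hw : (S 0).f ≫ P.d 0 (0 + 1) = 0 := by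
      rw [hd, (S 0).zero_assoc, zero_comp]
    let φ : (S 0).X₁ ⟶ P.cycles 0 := P.liftCycles (S 0).f (0 + 1) (by simp) hw
    have hφ : φ ≫ P.iCycles 0 = (S 0).f := P.liftCycles_i _ _ _ _
    let ψ : P.cycles 0 ⟶ (S 0).X₁ :=
      (hS 0).exact.lift (P.iCycles 0) (hd_eq_zero 0 _ (P.iCycles_d 0 (0 + 1)))
    have hψ : ψ ≫ (S 0).f = P.iCycles 0 := (hS 0).exact.lift_f _ _
    exact
      { hom := φ
        inv := ψ
        hom_inv_id := by simp [← cancel_mono (S 0).f, hψ, hφ]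
        inv_hom_id := by simp [← cancel_mono (P.iCycles 0), hψ, hφ] }

variable [EnoughProjectives 𝒜]

lemma HasOrthogonalCoresolution.exists_projective_cover {M : 𝒜}
    (h : HasOrthogonalCoresolution M) :
    ∃ (K P : 𝒜) (f : K ⟶ P) (g : P ⟶ M) (w : f ≫ g = 0), Projective P ∧
      (ShortComplex.mk f g w).ShortExact ∧ HasOrthogonalCoresolution K := by
  have hS : (ShortComplex.mk _ _ (kernel.condition (Projective.π M))).ShortExact :=
    { exact := ShortComplex.kernelSequence_exact _
      mono_f := inferInstanceAs (Mono (kernel.ι _))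
      epi_g := inferInstanceAs (Epi (Projective.π M)) }
  exact ⟨_, _, _, _, _, inferInstance, hS, kernel hS (of_projective _) h⟩

lemma HasOrthogonalCoresolution.isGorensteinProjective {M : 𝒜}
    (h : HasOrthogonalCoresolution M) : IsGorensteinProjective M := by
  let T := {S : ShortComplex 𝒜 // S.ShortExact ∧ Projective S.X₂ ∧
    HasOrthogonalCoresolution S.X₁ ∧ HasOrthogonalCoresolution S.X₃}
  obtain ⟨P, Y, f, g, w, hP, hS, hY⟩ := h.embedding
  obtain ⟨s, hs₀, hs⟩ := exists_int_orbit (fun t t' : T => Nonempty (t.1.X₃ ≅ t'.1.X₁))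
    (by
      rintro ⟨S, -, -, -, h₃⟩
      obtain ⟨P, Y, f, g, w, hP, hS, hY⟩ := h₃.embedding
      exact ⟨⟨_, hS, hP, h₃, hY⟩, ⟨Iso.refl _⟩⟩)
    (by
      rintro ⟨S, -, -, h₁, -⟩
      obtain ⟨K, P, f, g, w, hP, hS, hK⟩ := h₁.exists_projective_cover
      exact ⟨⟨_, hS, hP, hK, h₁⟩, ⟨Iso.refl _⟩⟩)
    ⟨_, hS, hP, h, hY⟩
  have := isGorensteinProjective_of_splice (fun n => (s n).1) (fun n => (s n).2.1)
    (fun n => (s n).2.2.1) (fun n => (s n).2.2.2.2.orthogonal) (fun n => (hs n).some)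
  rwa [hs₀] at this

lemma isGorensteinProjective_iff {M : 𝒜} :
    IsGorensteinProjective M ↔ HasOrthogonalCoresolution M :=
  ⟨fun h => h.hasOrthogonalCoresolution, fun h => h.isGorensteinProjective⟩

end GorensteinProjectiveCoresolution

end Paper

/-- in an abelian category with enough projectives and injectives, the
class of Gorenstein projective objects together with the class of projective objects is a
strong left Frobenius pair. -/
theorem statement12
    {𝒜 : Type u} [Category.{v} 𝒜] [Abelian 𝒜] [EnoughProjectives 𝒜] [EnoughInjectives 𝒜]
    [HasExt.{w₁} 𝒜] :
    IsStrongLeftFrobeniusPair {M : 𝒜 | IsGorensteinProjective M}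
      {M : 𝒜 | Projective M} := by
  have hset : {M : 𝒜 | IsGorensteinProjective M} = {M | HasOrthogonalCoresolution M} :=
    Set.ext fun _ => isGorensteinProjective_iff
  rw [hset]
  exact
    { closed_extensions := fun _ hS h₁ h₃ => HasOrthogonalCoresolution.extension hS h₁ h₃
      closed_kernels_of_epis := fun _ hS h₂ h₃ => HasOrthogonalCoresolution.kernel hS h₂ h₃
      closed_summands_X := fun _ _ _ hC ⟨e⟩ =>
        HasOrthogonalCoresolution.of_biprod (HasOrthogonalCoresolution.of_iso hC e)
      closed_summands_W := fun C A B hC ⟨e⟩ =>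
        have : Projective C := hC
        Retract.projective (Y := C) ⟨biprod.inl ≫ e.inv, e.hom ≫ biprod.fst, by simp⟩
      W_subset_X := fun M hM =>
        have : Projective M := hM
        HasOrthogonalCoresolution.of_projective M
      W_subset_rightPerp := fun W hW X hX i hi => by
        obtain ⟨i, rfl⟩ := Nat.exists_eq_add_of_le' hi
        exact HasOrthogonalCoresolution.orthogonal hX W hW i
      cogenerator := fun X hX => by
        obtain ⟨P, Y, f, g, w, hP, hS, hY⟩ := HasOrthogonalCoresolution.embedding hX
        exact ⟨_, hS, rfl, hP, hY⟩
      W_subset_leftPerp := fun W hW X _ i hi => by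
        obtain ⟨i, rfl⟩ := Nat.exists_eq_add_of_le' hi
        have : Projective W := hW
        exact Abelian.Ext.subsingleton_of_projective _ _ _
      generator := fun X hX => by
        obtain ⟨K, P, f, g, w, hP, hS, hK⟩ :=
          HasOrthogonalCoresolution.exists_projective_cover hX
        exact ⟨_, hS, rfl, hP, hK⟩ }
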